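/- arXiv:1202.1771 — 8 statements merged into one kernel-verified Lean document; each statement's English description precedes it below -/
import Mathlib

section
/- The function (q1,q2) ↦ J(q1,q2) is infinitely differentiable (C^∞ in the real sense) on the open set {(q1,q2) ∈ ℝ² : q2 ≠ 0}. -/
/-- The self-gravitation potential of the zero-angular-momentum Riemann liquid
ellipsoid problem (coupling constant `α = 1`), with `r = √(q1² + q2²)`. -/
noncomputable def J (q1 q2 : ℝ) : ℝ :=
  ∫ z in Set.Ioi (0 : ℝ),
    1 / Real.sqrt ((z + 4 / q2 ^ 2) *
      (z ^ 2 + Real.sqrt (q1 ^ 2 + q2 ^ 2) * z + q2 ^ 2 / 4))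

open Set Filter Topology MeasureTheory

/-- The integrands obtained from that of `J` by differentiating in `p = (a, r, c)`. -/
noncomputable def potentialKernel (j : ℕ) (σ τ : ℝ) (p : ℝ × ℝ × ℝ) (z : ℝ) : ℝ :=
  z ^ j * (z + p.1) ^ σ * (z ^ 2 + p.2.1 * z + p.2.2) ^ τ

/-- The open positive octant of `ℝ³`. -/
def positiveOctant : Set (ℝ × ℝ × ℝ) := {p | 0 < p.1 ∧ 0 < p.2.1 ∧ 0 < p.2.2}

/-- The Fréchet derivative of `potentialKernel` in its parameters. -/
noncomputable def potentialKernelDeriv (j : ℕ) (σ τ : ℝ) (p : ℝ × ℝ × ℝ) (z : ℝ) :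
    ℝ × ℝ × ℝ →L[ℝ] ℝ :=
  potentialKernel j (σ - 1) τ p z • (σ • ContinuousLinearMap.fst ℝ ℝ (ℝ × ℝ)) +
  potentialKernel (j + 1) σ (τ - 1) p z •
    (τ • (ContinuousLinearMap.fst ℝ ℝ ℝ).comp (ContinuousLinearMap.snd ℝ ℝ (ℝ × ℝ))) +
  potentialKernel j σ (τ - 1) p z •
    (τ • (ContinuousLinearMap.snd ℝ ℝ ℝ).comp (ContinuousLinearMap.snd ℝ ℝ (ℝ × ℝ)))

theorem isOpen_setOf_lt_prod (a : ℝ × ℝ × ℝ) :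
    IsOpen {p : ℝ × ℝ × ℝ | a.1 < p.1 ∧ a.2.1 < p.2.1 ∧ a.2.2 < p.2.2} :=
  (isOpen_lt continuous_const continuous_fst).inter
    ((isOpen_lt continuous_const continuous_snd.fst).inter
      (isOpen_lt continuous_const continuous_snd.snd))

theorem isOpen_positiveOctant : IsOpen positiveOctant :=
  isOpen_setOf_lt_prod 0

section Kernel

variable {j : ℕ} {σ τ : ℝ} {p q : ℝ × ℝ × ℝ} {z : ℝ}

theorem potentialKernel_nonneg (hp : p ∈ positiveOctant) (hz : 0 ≤ z) :
    0 ≤ potentialKernel j σ τ p z := by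
  obtain ⟨h1, h2, h3⟩ := hp
  unfold potentialKernel
  positivity

theorem potentialKernel_anti (hσ : σ ≤ 0) (hτ : τ ≤ 0) (hp : p ∈ positiveOctant)
    (hpq : p ≤ q) (hz : 0 ≤ z) : potentialKernel j σ τ q z ≤ potentialKernel j σ τ p z := by
  obtain ⟨h1, h2, h3⟩ := hp
  obtain ⟨k1, k2, k3⟩ := hpq
  unfold potentialKernel
  have hq1 := h1.trans_le k1
  have hq2 := h2.trans_le k2
  have hq3 := h3.trans_le k3
  have e1 : (z + q.1) ^ σ ≤ (z + p.1) ^ σ :=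
    Real.rpow_le_rpow_of_nonpos (by positivity) (by linarith) hσ
  have e2 : (z ^ 2 + q.2.1 * z + q.2.2) ^ τ ≤ (z ^ 2 + p.2.1 * z + p.2.2) ^ τ :=
    Real.rpow_le_rpow_of_nonpos (by positivity) (by gcongr) hτ
  gcongr

theorem continuousOn_potentialKernel (hp : p ∈ positiveOctant) :
    ContinuousOn (potentialKernel j σ τ p) (Ici 0) := by
  obtain ⟨h1, h2, h3⟩ := hp
  unfold potentialKernel
  refine ((continuousOn_id.pow j).mul (ContinuousOn.rpow_const (by fun_prop) ?_)).mul
    (ContinuousOn.rpow_const (by fun_prop) ?_)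
  · intro z (hz : 0 ≤ z)
    left; positivity
  · intro z (hz : 0 ≤ z)
    left; positivity

theorem integrableOn_potentialKernel (hσ : σ ≤ 0) (hτ : τ ≤ 0) (h : j + σ + 2 * τ < -1)
    (hp : p ∈ positiveOctant) : IntegrableOn (potentialKernel j σ τ p) (Ioi 0) := by
  have hcont : ContinuousOn (potentialKernel j σ τ p) (Ici 0) := continuousOn_potentialKernel hp
  rw [← Ioc_union_Ioi_eq_Ioi (zero_le_one' ℝ), integrableOn_union]
  constructor
  · exact ((hcont.mono Icc_subset_Ici_self).integrableOn_Icc).mono_set Ioc_subset_Icc_self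
  · refine (integrableOn_Ioi_rpow_of_lt h one_pos).mono'
      ((hcont.mono fun z (hz : 1 < z) => (zero_lt_one.trans hz).le).aestronglyMeasurable
        measurableSet_Ioi) ?_
    refine (ae_restrict_mem measurableSet_Ioi).mono fun z (hz : 1 < z) => ?_
    have hz0 : 0 < z := zero_lt_one.trans hz
    rw [Real.norm_of_nonneg (potentialKernel_nonneg hp hz0.le)]
    obtain ⟨h1, h2, h3⟩ := hp
    have e1 : (z + p.1) ^ σ ≤ z ^ σ :=
      Real.rpow_le_rpow_of_nonpos hz0 (by linarith) hσ
    have e2 : (z ^ 2 + p.2.1 * z + p.2.2) ^ τ ≤ (z ^ 2) ^ τ :=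
      Real.rpow_le_rpow_of_nonpos (by positivity) (by nlinarith [mul_pos h2 hz0]) hτ
    calc potentialKernel j σ τ p z ≤ z ^ j * z ^ σ * (z ^ 2) ^ τ := by
          unfold potentialKernel
          gcongr
      _ = z ^ (j + σ + 2 * τ) := by
          rw [Real.rpow_add hz0, Real.rpow_add hz0, Real.rpow_natCast, Real.rpow_mul hz0.le,
            Real.rpow_two]

theorem hasFDerivAt_potentialKernel (hp : p ∈ positiveOctant) (hz : 0 ≤ z) :
    HasFDerivAt (fun q => potentialKernel j σ τ q z) (potentialKernelDeriv j σ τ p z) p := by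
  obtain ⟨h1, h2, h3⟩ := hp
  have d1 : HasFDerivAt (fun q : ℝ × ℝ × ℝ => z + q.1)
      (ContinuousLinearMap.fst ℝ ℝ (ℝ × ℝ)) p := hasFDerivAt_fst.const_add z
  have d2 : HasFDerivAt (fun q : ℝ × ℝ × ℝ => z ^ 2 + q.2.1 * z + q.2.2)
      (z • (ContinuousLinearMap.fst ℝ ℝ ℝ).comp (ContinuousLinearMap.snd ℝ ℝ (ℝ × ℝ)) +
        (ContinuousLinearMap.snd ℝ ℝ ℝ).comp (ContinuousLinearMap.snd ℝ ℝ (ℝ × ℝ))) p :=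
    (((hasFDerivAt_fst.comp p hasFDerivAt_snd).mul_const z).const_add (z ^ 2)).add
      (hasFDerivAt_snd.comp p hasFDerivAt_snd)
  have e1 := d1.rpow_const (p := σ) (Or.inl (by positivity))
  have e2 := d2.rpow_const (p := τ) (Or.inl (by positivity))
  refine ((e1.const_mul (z ^ j)).mul e2).congr_fderiv ?_
  ext <;> simp [potentialKernelDeriv, potentialKernel] <;> ring

theorem hasFDerivAt_integral_potentialKernel (hσ : σ ≤ 0) (hτ : τ ≤ 0)
    (h : j + σ + 2 * τ < -1) (hp : p ∈ positiveOctant) :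
    HasFDerivAt (fun q => ∫ z in Ioi 0, potentialKernel j σ τ q z)
      ((∫ z in Ioi 0, potentialKernel j (σ - 1) τ p z) •
          (σ • ContinuousLinearMap.fst ℝ ℝ (ℝ × ℝ)) +
        (∫ z in Ioi 0, potentialKernel (j + 1) σ (τ - 1) p z) •
          (τ • (ContinuousLinearMap.fst ℝ ℝ ℝ).comp (ContinuousLinearMap.snd ℝ ℝ (ℝ × ℝ))) +
        (∫ z in Ioi 0, potentialKernel j σ (τ - 1) p z) •
          (τ • (ContinuousLinearMap.snd ℝ ℝ ℝ).comp (ContinuousLinearMap.snd ℝ ℝ (ℝ × ℝ)))) p := by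
  have i1 : ∀ {q}, q ∈ positiveOctant →
      IntegrableOn (potentialKernel j (σ - 1) τ q) (Ioi 0) :=
    integrableOn_potentialKernel (by linarith) hτ (by linarith)
  have i2 : ∀ {q}, q ∈ positiveOctant →
      IntegrableOn (potentialKernel (j + 1) σ (τ - 1) q) (Ioi 0) :=
    integrableOn_potentialKernel hσ (by linarith) (by push_cast; linarith)
  have i3 : ∀ {q}, q ∈ positiveOctant →
      IntegrableOn (potentialKernel j σ (τ - 1) q) (Ioi 0) :=
    integrableOn_potentialKernel hσ (by linarith) (by linarith)
  set A := σ • ContinuousLinearMap.fst ℝ ℝ (ℝ × ℝ)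
  set B := τ • (ContinuousLinearMap.fst ℝ ℝ ℝ).comp (ContinuousLinearMap.snd ℝ ℝ (ℝ × ℝ))
  set C := τ • (ContinuousLinearMap.snd ℝ ℝ ℝ).comp (ContinuousLinearMap.snd ℝ ℝ (ℝ × ℝ))
  set m : ℝ × ℝ × ℝ := (p.1 / 2, p.2.1 / 2, p.2.2 / 2)
  obtain ⟨h1, h2, h3⟩ := id hp
  have hmP : m ∈ positiveOctant := ⟨half_pos h1, half_pos h2, half_pos h3⟩
  have hs : {q : ℝ × ℝ × ℝ | m.1 < q.1 ∧ m.2.1 < q.2.1 ∧ m.2.2 < q.2.2} ∈ 𝓝 p :=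
    (isOpen_setOf_lt_prod m).mem_nhds ⟨half_lt_self h1, half_lt_self h2, half_lt_self h3⟩
  have j1 := (i1 hp).smul_const A
  have j2 := (i2 hp).smul_const B
  have j3 := (i3 hp).smul_const C
  have key := hasFDerivAt_integral_of_dominated_of_fderiv_le (μ := volume.restrict (Ioi (0 : ℝ)))
    (F := potentialKernel j σ τ) (F' := potentialKernelDeriv j σ τ) (x₀ := p)
    (bound := fun z => potentialKernel j (σ - 1) τ m z * ‖A‖ +
      potentialKernel (j + 1) σ (τ - 1) m z * ‖B‖ + potentialKernel j σ (τ - 1) m z * ‖C‖)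
    hs
    ((isOpen_positiveOctant.eventually_mem hp).mono fun q hq =>
      (integrableOn_potentialKernel hσ hτ h hq).aestronglyMeasurable)
    (integrableOn_potentialKernel hσ hτ h hp)
    ((j1.add j2).add j3).aestronglyMeasurable
    ((ae_restrict_mem measurableSet_Ioi).mono ?_)
    ((((i1 hmP).mul_const _).add ((i2 hmP).mul_const _)).add ((i3 hmP).mul_const _))
    ((ae_restrict_mem measurableSet_Ioi).mono ?_)
  · refine key.congr_fderiv ?_
    refine (integral_add (j1.add j2) j3).trans (congrArg₂ _ ((integral_add j1 j2).trans ?_) ?_)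
    · exact congrArg₂ _ (integral_smul_const _ _) (integral_smul_const _ _)
    · exact integral_smul_const _ _
  · rintro z (hz : 0 < z) q ⟨k1, k2, k3⟩
    have hq : q ∈ positiveOctant := ⟨hmP.1.trans k1, hmP.2.1.trans k2, hmP.2.2.trans k3⟩
    have hmq : m ≤ q := ⟨k1.le, k2.le, k3.le⟩
    have bound : ∀ (i : ℕ) {s t : ℝ} (L : ℝ × ℝ × ℝ →L[ℝ] ℝ), s ≤ 0 → t ≤ 0 →
        ‖potentialKernel i s t q z • L‖ ≤ potentialKernel i s t m z * ‖L‖ := by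
      intro i s t L hs ht
      rw [norm_smul, Real.norm_of_nonneg (potentialKernel_nonneg hq hz.le)]
      gcongr
      exact potentialKernel_anti hs ht hmP hmq hz.le
    refine norm_add₃_le.trans (add_le_add_three ?_ ?_ ?_)
    · exact bound _ _ (by linarith) hτ
    · exact bound _ _ hσ (by linarith)
    · exact bound _ _ hσ (by linarith)
  · rintro z (hz : 0 < z) q ⟨k1, k2, k3⟩
    exact hasFDerivAt_potentialKernel
      ⟨hmP.1.trans k1, hmP.2.1.trans k2, hmP.2.2.trans k3⟩ hz.le

theorem contDiffOn_integral_potentialKernel (n : ℕ) (hσ : σ ≤ 0) (hτ : τ ≤ 0)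
    (h : j + σ + 2 * τ < -1) :
    ContDiffOn ℝ n (fun q => ∫ z in Ioi 0, potentialKernel j σ τ q z) positiveOctant := by
  induction n generalizing j σ τ with
  | zero =>
    exact contDiffOn_zero.2 fun p hp =>
      (hasFDerivAt_integral_potentialKernel hσ hτ h hp).continuousAt.continuousWithinAt
  | succ n ih =>
    push_cast
    refine (contDiffOn_succ_iff_hasFDerivWithinAt_of_uniqueDiffOn
      isOpen_positiveOctant.uniqueDiffOn).2 ⟨by simp, _, ?_, fun p hp =>
        (hasFDerivAt_integral_potentialKernel hσ hτ h hp).hasFDerivWithinAt⟩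
    refine ((ContDiffOn.smul (ih ?_ ?_ ?_) contDiffOn_const).add
      (ContDiffOn.smul (ih ?_ ?_ ?_) contDiffOn_const)).add
      (ContDiffOn.smul (ih ?_ ?_ ?_) contDiffOn_const)
    all_goals first | linarith | (push_cast; linarith)

end Kernel

theorem J_eq_integral_potentialKernel {q1 q2 : ℝ} (h : q2 ≠ 0) :
    J q1 q2 = ∫ z in Ioi 0, potentialKernel 0 (-(1 / 2)) (-(1 / 2))
      (4 / q2 ^ 2, Real.sqrt (q1 ^ 2 + q2 ^ 2), q2 ^ 2 / 4) z := by
  refine setIntegral_congr_fun measurableSet_Ioi fun z (hz : 0 < z) => ?_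
  have hx : 0 ≤ z + 4 / q2 ^ 2 := by positivity
  have hy : 0 ≤ z ^ 2 + Real.sqrt (q1 ^ 2 + q2 ^ 2) * z + q2 ^ 2 / 4 := by positivity
  simp only [potentialKernel, pow_zero, one_mul]
  rw [Real.sqrt_mul hx, Real.rpow_neg hx, Real.rpow_neg hy, ← Real.sqrt_eq_rpow,
    ← Real.sqrt_eq_rpow, one_div, mul_inv]

/-- The potential `(q1, q2) ↦ J (q1, q2)` is infinitely differentiable (real `C^∞`)
on the open set `{(q1, q2) ∈ ℝ² : q2 ≠ 0}`. -/
theorem contDiffOn_J :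
    ContDiffOn ℝ (⊤ : ℕ∞) (fun p : ℝ × ℝ => J p.1 p.2) {p : ℝ × ℝ | p.2 ≠ 0} := by
  have hpos : ∀ p ∈ {p : ℝ × ℝ | p.2 ≠ 0}, 0 < p.1 ^ 2 + p.2 ^ 2 := fun p (hp : p.2 ≠ 0) => by
    positivity
  have hG : ContDiffOn ℝ (⊤ : ℕ∞) (fun q => ∫ z in Ioi 0,
      potentialKernel 0 (-(1 / 2)) (-(1 / 2)) q z) positiveOctant :=
    contDiffOn_infty.2 fun n =>
      contDiffOn_integral_potentialKernel n (by norm_num) (by norm_num) (by norm_num)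
  have hφ : ContDiffOn ℝ (⊤ : ℕ∞) (fun p : ℝ × ℝ =>
      ((4 / p.2 ^ 2, Real.sqrt (p.1 ^ 2 + p.2 ^ 2), p.2 ^ 2 / 4) : ℝ × ℝ × ℝ))
      {p : ℝ × ℝ | p.2 ≠ 0} := by
    refine ContDiffOn.prodMk (contDiffOn_const.div (by fun_prop) fun p hp => pow_ne_zero 2 hp)
      (ContDiffOn.prodMk (ContDiffOn.sqrt (by fun_prop) fun p hp => (hpos p hp).ne')
        (by fun_prop))
  refine (hG.comp hφ fun p hp => ?_).congr fun p hp => J_eq_integral_potentialKernel hp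
  have hp' : p.2 ≠ 0 := hp
  exact ⟨by positivity, Real.sqrt_pos.2 (hpos p hp), by positivity⟩
end

section
/- For every real q2 > 2 one has the closed-form evaluation J(0,q2) = ∫₀^∞ dz / √((z + 4/q2²)·(z² + q2·z + q2²/4)) = 2·√2·q2·arccos(2√2 / q2^{3/2}) / √(q2³ − 8). -/
open Filter Topology in
/-- The substitution `u = √(z + a)` reduces this integral to that of `2 / (u² + (b - a))`. -/
theorem integral_Ioi_one_div_sqrt_mul_sq {a b : ℝ} (ha : 0 < a) (hab : a < b) :
    ∫ z in Set.Ioi (0 : ℝ), 1 / Real.sqrt ((z + a) * (z + b) ^ 2) =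
      2 / Real.sqrt (b - a) * Real.arccos (Real.sqrt (a / b)) := by
  have hb : 0 < b := ha.trans hab
  have hba : 0 < b - a := sub_pos.2 hab
  set c := Real.sqrt (b - a)
  have hc0 : 0 < c := Real.sqrt_pos.2 hba
  have hc2 : c ^ 2 = b - a := Real.sq_sqrt hba.le
  have hderiv : ∀ z ∈ Set.Ici (0 : ℝ),
      HasDerivAt (fun z => 2 / c * Real.arctan (Real.sqrt (z + a) / c))
        (1 / Real.sqrt ((z + a) * (z + b) ^ 2)) z := by
    intro z hz
    have hz : 0 ≤ z := hz
    have hza : 0 < z + a := by linarith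
    have hzb : 0 < z + b := by linarith
    have hs : 0 < Real.sqrt (z + a) := Real.sqrt_pos.2 hza
    have hs2 : Real.sqrt (z + a) ^ 2 = z + a := Real.sq_sqrt hza.le
    have hden : 1 + (Real.sqrt (z + a) / c) ^ 2 = (z + b) / c ^ 2 := by
      rw [div_pow, hs2, eq_div_iff (by positivity), add_mul, div_mul_cancel₀ _ (by positivity), hc2]
      ring
    refine ((((((hasDerivAt_id z).add_const a).sqrt hza.ne').div_const c).arctan).const_mul
      (2 / c)).congr_deriv ?_
    rw [Real.sqrt_mul hza.le, Real.sqrt_sq hzb.le, id, hden]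
    field_simp
  have hlim : Tendsto (fun z => 2 / c * Real.arctan (Real.sqrt (z + a) / c)) atTop
      (𝓝 (2 / c * (Real.pi / 2))) := by
    have h : Tendsto (fun z => Real.sqrt (z + a) / c) atTop atTop :=
      (Real.tendsto_sqrt_atTop.comp (tendsto_atTop_add_const_right _ a tendsto_id)).atTop_div_const
        hc0
    exact ((Real.tendsto_arctan_atTop.mono_right nhdsWithin_le_nhds).comp h).const_mul _
  rw [MeasureTheory.integral_Ioi_of_hasDerivAt_of_nonneg' hderiv (fun z _ => by positivity) hlim,
    Real.arccos_eq_arctan (Real.sqrt_pos.2 (div_pos ha hb)), Real.sq_sqrt (div_pos ha hb).le,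
    ← mul_sub, zero_add, ← Real.arctan_inv_of_pos (div_pos (Real.sqrt_pos.2 ha) hc0), inv_div,
    one_sub_div hb.ne', Real.sqrt_div hba.le, Real.sqrt_div ha.le,
    div_div_div_cancel_right₀ (Real.sqrt_pos.2 hb).ne']

/-- For every real `q2 > 2` one has the closed-form evaluation
`J(0,q2) = 2√2·q2·arccos(2√2/q2^(3/2)) / √(q2³ − 8)`. -/
theorem J_eq_closed_form_of_two_lt (q2 : ℝ) (hq2 : 2 < q2) :
    J 0 q2 =
      2 * Real.sqrt 2 * q2 * Real.arccos (2 * Real.sqrt 2 / q2 ^ ((3 : ℝ) / 2)) /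
        Real.sqrt (q2 ^ 3 - 8) := by
  have hq : 0 < q2 := by linarith
  have hq3 : 8 < q2 ^ 3 := by
    have := pow_lt_pow_left₀ hq2 (by norm_num) (three_ne_zero)
    linarith
  have hab : 4 / q2 ^ 2 < q2 / 2 := by
    rw [div_lt_div_iff₀ (by positivity) (by norm_num)]
    linarith [show q2 * q2 ^ 2 = q2 ^ 3 by ring]
  have hquad : ∀ z : ℝ, z ^ 2 + Real.sqrt (0 ^ 2 + q2 ^ 2) * z + q2 ^ 2 / 4 = (z + q2 / 2) ^ 2 := by
    intro z
    rw [zero_pow two_ne_zero, zero_add, Real.sqrt_sq hq.le]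
    ring
  have hsqrt : Real.sqrt (4 / q2 ^ 2 / (q2 / 2)) = 2 * Real.sqrt 2 / q2 ^ ((3 : ℝ) / 2) := by
    have hpow : (q2 ^ ((3 : ℝ) / 2)) ^ 2 = q2 ^ 3 := by
      rw [← Real.rpow_mul_natCast hq.le]
      norm_num
    rw [Real.sqrt_eq_iff_eq_sq (by positivity) (by positivity), div_pow, mul_pow, hpow,
      Real.sq_sqrt zero_le_two]
    field_simp
    norm_num
  have hdiff : Real.sqrt (q2 / 2 - 4 / q2 ^ 2) = Real.sqrt (q2 ^ 3 - 8) / (Real.sqrt 2 * q2) := by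
    rw [show q2 / 2 - 4 / q2 ^ 2 = (q2 ^ 3 - 8) / (2 * q2 ^ 2) by field_simp; ring,
      Real.sqrt_div (by linarith), Real.sqrt_mul zero_le_two, Real.sqrt_sq hq.le]
  simp only [J, hquad]
  rw [integral_Ioi_one_div_sqrt_mul_sq (by positivity) hab, hsqrt, hdiff]
  have h8 : 0 < Real.sqrt (q2 ^ 3 - 8) := Real.sqrt_pos.2 (by linarith)
  field_simp
end

section
/- For every real q2 > 0 and every real p2, the partial derivatives of the Hamiltonian H with respect to q1 and with respect to p1 both vanish at the point (q1,q2,p1,p2) = (0,q2,0,p2); that is, the derivative at 0 of the function x ↦ H(x,q2,0,p2) is 0, and the derivative at 0 of the function y ↦ H(0,q2,y,p2) is 0. -/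
/-- The Hamiltonian of the zero-angular-momentum Riemann liquid ellipsoid problem,
`H(q1,q2,p1,p2) = r·(p1² + q2⁴·p2²/(q2⁴ + r)) + J(q1,q2)` with `r = √(q1² + q2²)`. -/
noncomputable def H (q1 q2 p1 p2 : ℝ) : ℝ :=
  Real.sqrt (q1 ^ 2 + q2 ^ 2) *
      (p1 ^ 2 + q2 ^ 4 * p2 ^ 2 / (q2 ^ 4 + Real.sqrt (q1 ^ 2 + q2 ^ 2))) +
    J q1 q2

/-- The derivative of an even function vanishes at the origin. -/
theorem Function.Even.deriv_zero {f : ℝ → ℝ} (hf : Function.Even f) : deriv f 0 = 0 := by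
  have h := deriv_comp_neg f (0 : ℝ)
  rw [show (fun x => f (-x)) = f from funext hf, neg_zero] at h
  linarith

theorem even_H_fst (q2 p1 p2 : ℝ) : Function.Even fun x : ℝ => H x q2 p1 p2 := by
  intro x
  simp only [H, J, neg_sq]

theorem even_H_momentum (q1 q2 p2 : ℝ) : Function.Even fun y : ℝ => H q1 q2 y p2 := by
  intro y
  simp only [H, neg_sq]

/-- For every real `q2 > 0` and every real `p2`, the partial derivatives of `H` with
respect to `q1` and with respect to `p1` both vanish at `(q1,q2,p1,p2) = (0,q2,0,p2)`. -/
theorem partials_H_vanish (q2 p2 : ℝ) (hq2 : 0 < q2) :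
    deriv (fun x : ℝ => H x q2 0 p2) 0 = 0 ∧
    deriv (fun y : ℝ => H 0 q2 y p2) 0 = 0 := by
  exact ⟨(even_H_fst q2 0 p2).deriv_zero, (even_H_momentum 0 q2 p2).deriv_zero⟩
end

section
/- The plane {p1 = 0, q1 = 0} is invariant under the Hamiltonian flow of H: if c = (q1,q2,p1,p2) : ℝ → ℝ⁴ is differentiable, satisfies q2(t) > 0 for all t, satisfies Hamilton's equations q1' = ∂H/∂p1, q2' = ∂H/∂p2, p1' = −∂H/∂q1, p2' = −∂H/∂q2 at every t, and satisfies q1(0) = 0 and p1(0) = 0, then q1(t) = 0 and p1(t) = 0 for all t ∈ ℝ. -/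
open Set Filter Topology MeasureTheory

lemma integral_Ioi_inv_add_sq {h : ℝ} (hh : 0 < h) :
    IntegrableOn (fun z : ℝ => ((z + h) ^ 2)⁻¹) (Ioi 0) ∧
      ∫ z in Ioi (0 : ℝ), ((z + h) ^ 2)⁻¹ = h⁻¹ := by
  have hd : ∀ z ∈ Ici (0 : ℝ),
      HasDerivAt (fun z : ℝ => -(z + h)⁻¹) ((z + h) ^ 2)⁻¹ z := by
    intro z hz
    have hz0 : z + h ≠ 0 := (add_pos_of_nonneg_of_pos hz hh).ne'
    refine (((hasDerivAt_id z).add_const h).inv hz0).neg.congr_deriv ?_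
    simp only [id]
    field_simp
  have ht : Tendsto (fun z : ℝ => -(z + h)⁻¹) atTop (𝓝 0) := by
    simpa using (tendsto_inv_atTop_zero.comp (tendsto_atTop_add_const_right _ h tendsto_id)).neg
  have hi := integrableOn_Ioi_deriv_of_nonneg' hd (fun z _ => by positivity) ht
  refine ⟨hi, ?_⟩
  rw [integral_Ioi_of_hasDerivAt_of_tendsto' hd hi ht]
  simp

lemma abs_one_div_sqrt_sub_le {A B c : ℝ} (hc : 0 < c) (hA : c ^ 2 ≤ A) (hB : c ^ 2 ≤ B) :
    |1 / √A - 1 / √B| ≤ |A - B| / (2 * c ^ 3) := by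
  have hX : c ≤ √A := Real.le_sqrt_of_sq_le hA
  have hY : c ≤ √B := Real.le_sqrt_of_sq_le hB
  have hX0 := hc.trans_le hX
  have hY0 := hc.trans_le hY
  have hAB : A - B = (√A - √B) * (√A + √B) := by
    linear_combination -Real.sq_sqrt ((sq_nonneg c).trans hA) + Real.sq_sqrt ((sq_nonneg c).trans hB)
  have key : 1 / √A - 1 / √B = -(A - B) / (√A * √B * (√A + √B)) := by
    rw [hAB]
    field_simp
    ring
  rw [key, abs_div, abs_neg, abs_of_pos (by positivity : 0 < √A * √B * (√A + √B))]
  refine div_le_div_of_nonneg_left (abs_nonneg _) (by positivity) ?_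
  calc 2 * c ^ 3 = c * c * (c + c) := by ring
    _ ≤ √A * √B * (√A + √B) := by gcongr

lemma abs_integrand_sub_le {a h s s' z : ℝ} (ha : 0 < a) (hh : 0 < h)
    (hs : 2 * h ≤ s) (hs' : 2 * h ≤ s') (hz : 0 < z) :
    |1 / √((z + a) * (z ^ 2 + s * z + h ^ 2)) - 1 / √((z + a) * (z ^ 2 + s' * z + h ^ 2))| ≤
      |s - s'| / (2 * √a) * ((z + h) ^ 2)⁻¹ := by
  have he : 0 < √a := Real.sqrt_pos.2 ha
  have hed : √a ≤ √(z + a) := Real.sqrt_le_sqrt (by linarith)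
  have hd2 : √(z + a) ^ 2 = z + a := Real.sq_sqrt (by positivity)
  set d := √(z + a)
  have hd : 0 < d := he.trans_le hed
  have bound : ∀ u, 2 * h ≤ u → (d * (z + h)) ^ 2 ≤ (z + a) * (z ^ 2 + u * z + h ^ 2) := by
    intro u hu
    rw [mul_pow, hd2]
    gcongr
    nlinarith
  refine (abs_one_div_sqrt_sub_le (by positivity : 0 < d * (z + h)) (bound s hs)
    (bound s' hs')).trans ?_
  have : (z + a) * (z ^ 2 + s * z + h ^ 2) - (z + a) * (z ^ 2 + s' * z + h ^ 2) =
      (s - s') * (d ^ 2 * z) := by rw [hd2]; ring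
  rw [this, abs_mul, abs_of_pos (by positivity : 0 < d ^ 2 * z)]
  calc |s - s'| * (d ^ 2 * z) / (2 * (d * (z + h)) ^ 3)
      ≤ |s - s'| * (d ^ 2 * (z + h)) / (2 * (d * (z + h)) ^ 3) := by
        gcongr
        linarith
    _ = |s - s'| / (2 * d) * ((z + h) ^ 2)⁻¹ := by field_simp
    _ ≤ |s - s'| / (2 * √a) * ((z + h) ^ 2)⁻¹ := by gcongr

/-- No integrability is needed: if one function is not integrable, neither is the other. -/
lemma abs_integral_sub_le_of_abs_sub_le {μ : Measure ℝ} {f g b : ℝ → ℝ} (hb : Integrable b μ)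
    (hf : Measurable f) (hg : Measurable g) (hfg : ∀ᵐ z ∂μ, |f z - g z| ≤ b z) :
    |∫ z, f z ∂μ - ∫ z, g z ∂μ| ≤ ∫ z, b z ∂μ := by
  have hd : Integrable (fun z => f z - g z) μ :=
    hb.mono' (hf.sub hg).aestronglyMeasurable hfg
  by_cases hgi : Integrable g μ
  · have hfi : Integrable f μ := (hd.add hgi).congr (ae_of_all _ fun z => by simp)
    rw [← integral_sub hfi hgi]
    exact norm_integral_le_of_norm_le (f := fun z => f z - g z) hb hfg
  · have hfi : ¬ Integrable f μ := fun hfi => hgi ((hfi.sub hd).congr (ae_of_all _ fun z => by simp))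
    rw [integral_undef hgi, integral_undef hfi, sub_zero, abs_zero]
    exact integral_nonneg_of_ae (hfg.mono fun z hz => (abs_nonneg _).trans hz)

lemma abs_J_sub_le {x y q : ℝ} (hq : 0 < q) :
    |J x q - J y q| ≤ 1 / 2 * |√(x ^ 2 + q ^ 2) - √(y ^ 2 + q ^ 2)| := by
  have hle : ∀ u : ℝ, 2 * (q / 2) ≤ √(u ^ 2 + q ^ 2) := fun u =>
    Real.le_sqrt_of_sq_le (by nlinarith [sq_nonneg u])
  obtain ⟨hi, hv⟩ := integral_Ioi_inv_add_sq (half_pos hq)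
  have ha : √(4 / q ^ 2) = 2 / q := by
    rw [show 4 / q ^ 2 = (2 / q) ^ 2 by ring, Real.sqrt_sq (by positivity)]
  have hq4 : q ^ 2 / 4 = (q / 2) ^ 2 := by ring
  unfold J
  rw [hq4]
  refine (abs_integral_sub_le_of_abs_sub_le
    (hi.const_mul (|√(x ^ 2 + q ^ 2) - √(y ^ 2 + q ^ 2)| / (2 * √(4 / q ^ 2))))
    (by fun_prop) (by fun_prop) ?_).trans_eq ?_
  · filter_upwards [ae_restrict_mem measurableSet_Ioi] with z hz
    exact abs_integrand_sub_le (by positivity) (half_pos hq) (hle x) (hle y) hz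
  · rw [integral_const_mul, hv, ha]
    field_simp

lemma abs_radius_sub_le {x y q : ℝ} (hq : 0 < q) :
    |√(x ^ 2 + q ^ 2) - √(y ^ 2 + q ^ 2)| ≤ |x + y| * |x - y| / (2 * q) := by
  have hX : q ≤ √(x ^ 2 + q ^ 2) := Real.le_sqrt_of_sq_le (by nlinarith [sq_nonneg x])
  have hY : q ≤ √(y ^ 2 + q ^ 2) := Real.le_sqrt_of_sq_le (by nlinarith [sq_nonneg y])
  have hx := Real.sq_sqrt (by positivity : 0 ≤ x ^ 2 + q ^ 2)
  have hy := Real.sq_sqrt (by positivity : 0 ≤ y ^ 2 + q ^ 2)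
  set X := √(x ^ 2 + q ^ 2)
  set Y := √(y ^ 2 + q ^ 2)
  rw [le_div_iff₀ (by positivity), ← abs_mul,
    show (x + y) * (x - y) = (X - Y) * (X + Y) by linear_combination hy - hx, abs_mul]
  gcongr
  exact (by linarith : 2 * q ≤ X + Y).trans (le_abs_self _)

lemma abs_kinetic_sub_le {r s q p p' : ℝ} (hq : 0 < q) (hr : 0 ≤ r) (hs : 0 ≤ s) :
    |r * (p ^ 2 + q ^ 4 * p' ^ 2 / (q ^ 4 + r)) - s * (p ^ 2 + q ^ 4 * p' ^ 2 / (q ^ 4 + s))| ≤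
      (p ^ 2 + p' ^ 2) * |r - s| := by
  have key : r * (p ^ 2 + q ^ 4 * p' ^ 2 / (q ^ 4 + r)) -
      s * (p ^ 2 + q ^ 4 * p' ^ 2 / (q ^ 4 + s)) =
      (p ^ 2 + p' ^ 2 * (q ^ 4 * q ^ 4 / ((q ^ 4 + r) * (q ^ 4 + s)))) * (r - s) := by
    field_simp
    ring
  have hle : q ^ 4 * q ^ 4 / ((q ^ 4 + r) * (q ^ 4 + s)) ≤ 1 := by
    rw [div_le_one (by positivity)]
    gcongr <;> linarith
  rw [key, abs_mul, abs_of_nonneg (by positivity)]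
  gcongr
  exact mul_le_of_le_one_right (sq_nonneg _) hle

lemma abs_deriv_le_of_abs_sub_le {f : ℝ → ℝ} {L x : ℝ} (hL : 0 ≤ L)
    (hf : ∀ y, |f y - f x| ≤ L * |y + x| * |y - x|) : |deriv f x| ≤ 2 * L * |x| := by
  refine le_of_forall_gt_imp_ge_of_dense fun c hc => ?_
  have hc0 : 0 ≤ c := le_trans (by positivity) hc.le
  refine norm_deriv_le_of_lip' (f := f) hc0 ?_
  have ht : Tendsto (fun y : ℝ => L * |y + x|) (𝓝 x) (𝓝 (L * |x + x|)) :=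
    Continuous.tendsto (by fun_prop) x
  have hlt : L * |x + x| < c := by
    rwa [← two_mul, abs_mul, abs_two, ← mul_assoc, mul_comm L]
  filter_upwards [ht.eventually_lt_const hlt] with y hy
  exact (hf y).trans (by rw [Real.norm_eq_abs]; gcongr)

lemma abs_deriv_H_q1_le {x q p p' : ℝ} (hq : 0 < q) :
    |deriv (fun y => H y q p p') x| ≤ (p ^ 2 + p' ^ 2 + 1 / 2) / q * |x| := by
  refine (abs_deriv_le_of_abs_sub_le (L := (p ^ 2 + p' ^ 2 + 1 / 2) / (2 * q))
    (by positivity) fun y => ?_).trans_eq (by field_simp)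
  have hk := abs_kinetic_sub_le (p := p) (p' := p') hq (Real.sqrt_nonneg (y ^ 2 + q ^ 2))
    (Real.sqrt_nonneg (x ^ 2 + q ^ 2))
  have hJ := abs_J_sub_le (x := y) (y := x) hq
  have hr := abs_radius_sub_le (x := y) (y := x) hq
  unfold H
  rw [add_sub_add_comm]
  calc _ ≤ (p ^ 2 + p' ^ 2 + 1 / 2) * |√(y ^ 2 + q ^ 2) - √(x ^ 2 + q ^ 2)| := by
        refine (abs_add_le _ _).trans ?_
        linarith
    _ ≤ (p ^ 2 + p' ^ 2 + 1 / 2) * (|y + x| * |y - x| / (2 * q)) := by gcongr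
    _ = _ := by ring

lemma deriv_H_p1 (x q p p' : ℝ) :
    deriv (fun y => H x q y p') p = 2 * √(x ^ 2 + q ^ 2) * p := by
  unfold H
  refine HasDerivAt.deriv ?_
  refine ((((hasDerivAt_id p).pow 2).add_const _).const_mul _ |>.add_const _).congr_deriv ?_
  simp
  ring

lemma eq_zero_of_norm_deriv_le_of_nonneg {E : Type*} [NormedAddCommGroup E] [NormedSpace ℝ E]
    {f f' : ℝ → E} {K : ℝ → ℝ} (hK : Continuous K) (hf : ∀ t, HasDerivAt f (f' t) t)
    (h0 : f 0 = 0) (hb : ∀ t, ‖f' t‖ ≤ K t * ‖f t‖) {t : ℝ} (ht : 0 ≤ t) : f t = 0 := by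
  obtain ⟨C, hC⟩ := isCompact_Icc.bddAbove_image (hK.continuousOn (s := Icc 0 t))
  refine eq_zero_of_abs_deriv_le_mul_abs_self_of_eq_zero_right (K := C) (a := 0) (b := t)
    (fun s _ => (hf s).continuousAt.continuousWithinAt) (fun s _ => (hf s).hasDerivWithinAt) h0
    (fun s hs => (hb s).trans ?_) t (right_mem_Icc.2 ht)
  gcongr
  exact hC (mem_image_of_mem K (Ico_subset_Icc_self hs))

lemma eq_zero_of_norm_deriv_le {E : Type*} [NormedAddCommGroup E] [NormedSpace ℝ E]
    {f f' : ℝ → E} {K : ℝ → ℝ} (hK : Continuous K) (hf : ∀ t, HasDerivAt f (f' t) t)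
    (h0 : f 0 = 0) (hb : ∀ t, ‖f' t‖ ≤ K t * ‖f t‖) (t : ℝ) : f t = 0 := by
  rcases le_total 0 t with ht | ht
  · exact eq_zero_of_norm_deriv_le_of_nonneg hK hf h0 hb ht
  · have := eq_zero_of_norm_deriv_le_of_nonneg (f := fun s => f (-s)) (f' := fun s => -f' (-s))
      (hK.comp continuous_neg)
      (fun s => by simpa [Function.comp_def] using (hf (-s)).scomp s (hasDerivAt_neg s)) (by simpa using h0)
      (fun s => by simpa using hb (-s)) (neg_nonneg.2 ht)
    simpa using this

/-- The plane `{p1 = 0, q1 = 0}` is invariant under the Hamiltonian flow of `H`: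
any differentiable solution of Hamilton's equations with `q2 > 0` everywhere that
starts with `q1 0 = 0` and `p1 0 = 0` satisfies `q1 t = 0` and `p1 t = 0` for all `t`. -/
theorem invariant_plane (q1 q2 p1 p2 : ℝ → ℝ)
    (hq1 : Differentiable ℝ q1) (hq2 : Differentiable ℝ q2)
    (hp1 : Differentiable ℝ p1) (hp2 : Differentiable ℝ p2)
    (hq2pos : ∀ t, 0 < q2 t)
    (ham_q1 : ∀ t, deriv q1 t =
      deriv (fun y : ℝ => H (q1 t) (q2 t) y (p2 t)) (p1 t))
    (ham_q2 : ∀ t, deriv q2 t =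
      deriv (fun y : ℝ => H (q1 t) (q2 t) (p1 t) y) (p2 t))
    (ham_p1 : ∀ t, deriv p1 t =
      - deriv (fun x : ℝ => H x (q2 t) (p1 t) (p2 t)) (q1 t))
    (ham_p2 : ∀ t, deriv p2 t =
      - deriv (fun x : ℝ => H (q1 t) x (p1 t) (p2 t)) (q2 t))
    (hq10 : q1 0 = 0) (hp10 : p1 0 = 0) :
    ∀ t : ℝ, q1 t = 0 ∧ p1 t = 0 := by
  have hc1 := hq1.continuous
  have hc2 := hq2.continuous
  have hd1 := hp1.continuous
  have hd2 := hp2.continuous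
  have hzero := eq_zero_of_norm_deriv_le (f := fun t => (q1 t, p1 t))
    (f' := fun t => (deriv q1 t, deriv p1 t))
    (K := fun t => max (2 * √(q1 t ^ 2 + q2 t ^ 2)) ((p1 t ^ 2 + p2 t ^ 2 + 1 / 2) / q2 t))
    (Continuous.max (by fun_prop)
      (Continuous.div (by fun_prop) hc2 fun t => (hq2pos t).ne'))
    (fun t => (hq1 t).hasDerivAt.prodMk (hp1 t).hasDerivAt) (by simp [hq10, hp10]) ?_
  · exact fun t => Prod.mk_eq_zero.1 (hzero t)
  · intro t
    have hq := hq2pos t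
    rw [Prod.norm_mk, Prod.norm_mk]
    refine max_le ?_ ?_
    · rw [ham_q1, deriv_H_p1, norm_mul, Real.norm_of_nonneg (by positivity)]
      gcongr
      · exact le_max_left _ _
      · exact le_max_right _ _
    · rw [ham_p1, norm_neg]
      refine (abs_deriv_H_q1_le hq).trans ?_
      gcongr
      · exact le_max_right _ _
      · exact le_max_left _ _
end

section
/- For every real q2 > 0, the second derivative at q1 = 0 of the function q1 ↦ J(q1,q2) is given by the convergent integral deriv² (q1 ↦ J(q1,q2)) |_{q1=0} = − ∫₀^∞ 4z / (√(z·q2² + 4)·(2z + q2)³) dz. -/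
open MeasureTheory Set Filter Topology

theorem integrableOn_one_div_sqrt_cubic {a c : ℝ} (ha : 0 < a) (hc : 0 < c) :
    IntegrableOn (fun z : ℝ => 1 / √((z + a) * (z ^ 2 + c))) (Ioi 0) := by
  obtain ⟨m, hm, hma, hmc⟩ : ∃ m > 0, m ≤ a ∧ m ^ 2 ≤ c :=
    ⟨min a √c, by positivity, min_le_left _ _, by
      calc (min a √c) ^ 2 ≤ √c ^ 2 := by gcongr; exact min_le_right _ _
        _ = c := Real.sq_sqrt hc.le⟩
  have hI : IntegrableOn (fun z : ℝ => √2 * (z + m) ^ (-(3 / 2) : ℝ)) (Ioi 0) :=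
    (integrableOn_add_rpow_Ioi_of_lt (by norm_num) (by linarith)).const_mul _
  refine Integrable.mono' hI (Measurable.aestronglyMeasurable (by fun_prop)) ?_
  filter_upwards [ae_restrict_mem measurableSet_Ioi] with z (hz : 0 < z)
  rw [Real.norm_of_nonneg (by positivity)]
  have hzm : 0 < z + m := by positivity
  have hpow : (z + m) ^ (-(3 / 2) : ℝ) = 1 / √((z + m) ^ 3) := by
    rw [Real.sqrt_eq_rpow, ← Real.rpow_natCast, ← Real.rpow_mul hzm.le, Real.rpow_neg hzm.le,
      one_div]
    norm_num
  have hle : (z + m) ^ 3 ≤ 2 * ((z + a) * (z ^ 2 + c)) := by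
    calc (z + m) ^ 3 = (z + m) * (z + m) ^ 2 := by ring
      _ ≤ (z + a) * (2 * (z ^ 2 + c)) := by
        gcongr
        nlinarith [sq_nonneg (z - m)]
      _ = _ := by ring
  rw [hpow, mul_one_div, div_le_div_iff₀ (by positivity) (by positivity), one_mul,
    ← Real.sqrt_mul (by norm_num)]
  exact Real.sqrt_le_sqrt hle

theorem hasDerivAt_one_div_sqrt_linear {A z p r : ℝ} (hA : 0 < A) (hP : 0 < z ^ 2 + r * z + p) :
    HasDerivAt (fun s : ℝ => 1 / √(A * (z ^ 2 + s * z + p)))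
      (-(1 / √(A * (z ^ 2 + r * z + p)) * (z / (2 * (z ^ 2 + r * z + p))))) r := by
  have hAP : 0 < A * (z ^ 2 + r * z + p) := by positivity
  have h1 : HasDerivAt (fun s : ℝ => A * (z ^ 2 + s * z + p)) (A * z) r := by
    simpa using ((((hasDerivAt_id r).mul_const z).const_add (z ^ 2)).add_const p).const_mul A
  have h2 := (h1.sqrt hAP.ne').inv (Real.sqrt_pos.2 hAP).ne'
  simp only [one_div]
  refine h2.congr_deriv ?_
  rw [Real.sq_sqrt hAP.le]
  field_simp

theorem abs_deriv_one_div_sqrt_le {a c r z : ℝ} (ha : 0 < a) (hc : 0 < c) (hr : 0 < r)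
    (hz : 0 < z) :
    ‖-(1 / √((z + a) * (z ^ 2 + r * z + c)) * (z / (2 * (z ^ 2 + r * z + c))))‖ ≤
      1 / √((z + a) * (z ^ 2 + c)) * (1 / (2 * r)) := by
  rw [norm_neg, Real.norm_of_nonneg (by positivity)]
  gcongr ?_ * ?_
  · gcongr
    nlinarith [mul_pos hr hz]
  · rw [div_le_div_iff₀ (by positivity) (by positivity)]
    nlinarith [sq_nonneg z]

theorem integrableOn_deriv_one_div_sqrt {a c r : ℝ} (ha : 0 < a) (hc : 0 < c) (hr : 0 < r) :
    IntegrableOn (fun z : ℝ =>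
      -(1 / √((z + a) * (z ^ 2 + r * z + c)) * (z / (2 * (z ^ 2 + r * z + c))))) (Ioi 0) := by
  refine Integrable.mono' ((integrableOn_one_div_sqrt_cubic ha hc).mul_const (1 / (2 * r)))
    (Measurable.aestronglyMeasurable (by fun_prop)) ?_
  filter_upwards [ae_restrict_mem measurableSet_Ioi] with z hz
  exact abs_deriv_one_div_sqrt_le ha hc hr hz

theorem hasDerivAt_integral_one_div_sqrt {a c r : ℝ} (ha : 0 < a) (hc : 0 < c) (hr : 0 < r) :
    HasDerivAt (fun s : ℝ => ∫ z in Ioi (0 : ℝ), 1 / √((z + a) * (z ^ 2 + s * z + c)))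
      (∫ z in Ioi (0 : ℝ),
        -(1 / √((z + a) * (z ^ 2 + r * z + c)) * (z / (2 * (z ^ 2 + r * z + c))))) r := by
  have hB := integrableOn_one_div_sqrt_cubic ha hc
  refine (hasDerivAt_integral_of_dominated_loc_of_deriv_le
    (μ := volume.restrict (Ioi (0 : ℝ)))
    (F := fun s z => 1 / √((z + a) * (z ^ 2 + s * z + c)))
    (F' := fun s z => -(1 / √((z + a) * (z ^ 2 + s * z + c)) * (z / (2 * (z ^ 2 + s * z + c)))))
    (bound := fun z => 1 / √((z + a) * (z ^ 2 + c)) * (1 / (2 * (r / 2))))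
    (Ioi_mem_nhds (half_lt_self hr)) ?_ ?_ ?_ ?_ (hB.mul_const _) ?_).2
  · exact Eventually.of_forall fun s => Measurable.aestronglyMeasurable (by fun_prop)
  · refine Integrable.mono' hB (Measurable.aestronglyMeasurable (by fun_prop)) ?_
    filter_upwards [ae_restrict_mem measurableSet_Ioi] with z (hz : 0 < z)
    rw [Real.norm_of_nonneg (by positivity)]
    gcongr
    nlinarith [mul_pos hr hz]
  · exact Measurable.aestronglyMeasurable (by fun_prop)
  · filter_upwards [ae_restrict_mem measurableSet_Ioi] with z (hz : 0 < z) s (hs : r / 2 < s)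
    refine (abs_deriv_one_div_sqrt_le ha hc (by linarith) hz).trans ?_
    gcongr
  · filter_upwards [ae_restrict_mem measurableSet_Ioi] with z (hz : 0 < z) s (hs : r / 2 < s)
    have hs0 : 0 < s := by linarith
    exact hasDerivAt_one_div_sqrt_linear (by positivity) (by positivity)

theorem continuousAt_integral_deriv_one_div_sqrt {a c r : ℝ} (ha : 0 < a) (hc : 0 < c)
    (hr : 0 < r) :
    ContinuousAt (fun s : ℝ => ∫ z in Ioi (0 : ℝ),
      -(1 / √((z + a) * (z ^ 2 + s * z + c)) * (z / (2 * (z ^ 2 + s * z + c))))) r := by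
  refine continuousAt_of_dominated
    (bound := fun z => 1 / √((z + a) * (z ^ 2 + c)) * (1 / (2 * (r / 2))))
    (Eventually.of_forall fun s => Measurable.aestronglyMeasurable (by fun_prop)) ?_
    ((integrableOn_one_div_sqrt_cubic ha hc).mul_const _) ?_
  · filter_upwards [Ioi_mem_nhds (half_lt_self hr)] with s (hs : r / 2 < s)
    filter_upwards [ae_restrict_mem measurableSet_Ioi] with z (hz : 0 < z)
    refine (abs_deriv_one_div_sqrt_le ha hc (by linarith) hz).trans ?_
    gcongr
  · filter_upwards [ae_restrict_mem measurableSet_Ioi] with z (hz : 0 < z)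
    have h1 : √((z + a) * (z ^ 2 + r * z + c)) ≠ 0 := by positivity
    have h2 : 2 * (z ^ 2 + r * z + c) ≠ 0 := by positivity
    fun_prop (disch := assumption)

theorem hasDerivAt_mul_self_zero {k : ℝ → ℝ} (hk : ContinuousAt k 0) :
    HasDerivAt (fun x => k x * x) (k 0) 0 := by
  rw [hasDerivAt_iff_tendsto_slope]
  refine (hk.tendsto.mono_left nhdsWithin_le_nhds).congr' ?_
  filter_upwards [self_mem_nhdsWithin] with x (hx : x ≠ 0)
  simp [slope_def_field, hx]

theorem neg_deriv_one_div_sqrt_div_eq {q z : ℝ} (hq : 0 < q) (hz : 0 < z) :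
    4 * z / (√(z * q ^ 2 + 4) * (2 * z + q) ^ 3) =
      -(-(1 / √((z + 4 / q ^ 2) * (z ^ 2 + q * z + q ^ 2 / 4)) *
        (z / (2 * (z ^ 2 + q * z + q ^ 2 / 4)))) / q) := by
  have hsq : z ^ 2 + q * z + q ^ 2 / 4 = ((2 * z + q) / 2) ^ 2 := by ring
  have hA : (z + 4 / q ^ 2) * (z ^ 2 + q * z + q ^ 2 / 4) =
      (z * q ^ 2 + 4) * ((2 * z + q) / (2 * q)) ^ 2 := by
    field_simp
    ring
  rw [hA, Real.sqrt_mul (by positivity), Real.sqrt_sq (by positivity), hsq]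
  have : 0 < √(z * q ^ 2 + 4) := by positivity
  field_simp
  norm_num

/-- For every real `q2 > 0`, the second derivative at `q1 = 0` of `q1 ↦ J(q1,q2)` is
given by the convergent integral `−∫₀^∞ 4z/(√(z·q2² + 4)·(2z + q2)³) dz`. -/
theorem second_deriv_J_at_zero (q2 : ℝ) (hq2 : 0 < q2) :
    MeasureTheory.IntegrableOn
      (fun z : ℝ => 4 * z / (Real.sqrt (z * q2 ^ 2 + 4) * (2 * z + q2) ^ 3))
      (Set.Ioi (0 : ℝ)) ∧
    deriv (deriv (fun q1 : ℝ => J q1 q2)) 0 =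
      - ∫ z in Set.Ioi (0 : ℝ),
          4 * z / (Real.sqrt (z * q2 ^ 2 + 4) * (2 * z + q2) ^ 3) := by
  have ha : 0 < 4 / q2 ^ 2 := by positivity
  have hc : 0 < q2 ^ 2 / 4 := by positivity
  set D : ℝ → ℝ := fun r => ∫ z in Ioi (0 : ℝ),
    -(1 / √((z + 4 / q2 ^ 2) * (z ^ 2 + r * z + q2 ^ 2 / 4)) *
      (z / (2 * (z ^ 2 + r * z + q2 ^ 2 / 4)))) with hD
  have hr : ∀ x : ℝ, 0 < √(x ^ 2 + q2 ^ 2) := fun x => by positivity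
  have hr0 : √((0 : ℝ) ^ 2 + q2 ^ 2) = q2 := by simp [Real.sqrt_sq hq2.le]
  have hJ : deriv (fun q1 : ℝ => J q1 q2) =
      fun x => D √(x ^ 2 + q2 ^ 2) / √(x ^ 2 + q2 ^ 2) * x := by
    funext x
    have h1 : HasDerivAt (fun x : ℝ => √(x ^ 2 + q2 ^ 2)) (x / √(x ^ 2 + q2 ^ 2)) x := by
      refine (((hasDerivAt_pow 2 x).add_const (q2 ^ 2)).sqrt (by positivity)).congr_deriv ?_
      have := hr x
      field_simp
      norm_num
    have h2 := (hasDerivAt_integral_one_div_sqrt ha hc (hr x)).comp x h1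
    refine HasDerivAt.deriv (h2.congr_deriv ?_)
    simp only [hD]
    ring
  have hDc : ContinuousAt D √((0 : ℝ) ^ 2 + q2 ^ 2) :=
    continuousAt_integral_deriv_one_div_sqrt ha hc (hr 0)
  have hsqrt : ContinuousAt (fun x : ℝ => √(x ^ 2 + q2 ^ 2)) 0 := by fun_prop
  have hcont : ContinuousAt (fun x : ℝ => D √(x ^ 2 + q2 ^ 2) / √(x ^ 2 + q2 ^ 2)) 0 :=
    (ContinuousAt.comp (f := fun x : ℝ => √(x ^ 2 + q2 ^ 2)) hDc hsqrt).div hsqrt (hr 0).ne'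
  have heq := fun z (hz : z ∈ Ioi (0 : ℝ)) => neg_deriv_one_div_sqrt_div_eq hq2 hz
  constructor
  · exact (integrableOn_congr_fun heq measurableSet_Ioi).2
      ((integrableOn_deriv_one_div_sqrt ha hc hq2).div_const q2).neg
  · rw [hJ, (hasDerivAt_mul_self_zero hcont).deriv, hr0,
      setIntegral_congr_fun measurableSet_Ioi heq, integral_neg, integral_div, neg_neg]
end

section
/- For every real q2 > 2, the function x ↦ J(0,x) is differentiable at q2 with derivative d/dq2 [J(0,q2)] = 12/(q2³ − 8) − √2·(q2³ + 16)·arccos(2√2 / q2^{3/2}) / ((q2³ − 8)·√(q2³ − 8)). -/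
open Set Filter Topology MeasureTheory in
/-- For `0 ≤ a < b`, `√(z + a) ↦ 2 / √(b - a) * arctan (√(z + a) / √(b - a))` is a primitive of
the integrand, so the integral over the half-line is elementary. -/
theorem integral_Ioi_one_div_mul_sqrt_add {a b : ℝ} (ha : 0 < a) (hab : a < b) :
    ∫ z in Ioi (0 : ℝ), 1 / ((z + b) * √(z + a)) =
      2 / √(b - a) * (Real.pi / 2 - Real.arctan (√a / √(b - a))) := by
  have hc : 0 < √(b - a) := Real.sqrt_pos.2 (sub_pos.2 hab)
  have hc2 : √(b - a) ^ 2 = b - a := Real.sq_sqrt (sub_pos.2 hab).le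
  have hderiv : ∀ z ∈ Ici (0 : ℝ), HasDerivAt
      (fun z => 2 / √(b - a) * Real.arctan (√(z + a) / √(b - a)))
      (1 / ((z + b) * √(z + a))) z := by
    intro z hz
    have hz : 0 ≤ z := hz
    have hza : 0 < z + a := by positivity
    have hs : 0 < √(z + a) := Real.sqrt_pos.2 hza
    have hs2 : √(z + a) ^ 2 = z + a := Real.sq_sqrt hza.le
    refine (((((hasDerivAt_id z).add_const a).sqrt hza.ne').div_const
      (√(b - a))).arctan.const_mul (2 / √(b - a))).congr_deriv ?_
    have hb : z + b = √(b - a) ^ 2 + √(z + a) ^ 2 := by rw [hc2, hs2]; ring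
    rw [hb]
    simp only [id]
    have : √(b - a) ^ 2 + √(z + a) ^ 2 ≠ 0 := by positivity
    field_simp
  have hlim : Tendsto (fun z => 2 / √(b - a) * Real.arctan (√(z + a) / √(b - a))) atTop
      (𝓝 (2 / √(b - a) * (Real.pi / 2))) := by
    refine Tendsto.const_mul _ ((tendsto_nhds_of_tendsto_nhdsWithin
      Real.tendsto_arctan_atTop).comp ?_)
    exact (Real.tendsto_sqrt_atTop.comp (tendsto_atTop_add_const_right _ a tendsto_id)).atTop_div_const
      hc
  rw [integral_Ioi_of_hasDerivAt_of_nonneg' hderiv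
    (fun z hz => by have hz : 0 < z := hz; have := ha.trans hab; positivity) hlim, zero_add]
  ring

theorem rpow_three_halves_eq_mul_sqrt {x : ℝ} (hx : 0 < x) : x ^ ((3 : ℝ) / 2) = x * √x := by
  rw [Real.sqrt_eq_rpow, ← Real.rpow_one_add' hx.le (by norm_num)]
  norm_num

/-- The value of `√(1 - y ^ 2)` at `y = 2 * √2 / (x * √x)`. -/
theorem sqrt_one_sub_sq_two_sqrt_two_div {x : ℝ} (hx : 0 < x) :
    √(1 - (2 * √2 / (x * √x)) ^ 2) = √(x ^ 3 - 8) / (x * √x) := by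
  have h2 : √(2 : ℝ) ^ 2 = 2 := Real.sq_sqrt (by norm_num)
  have hs : 0 < √x := Real.sqrt_pos.2 hx
  have hs2 : √x ^ 2 = x := Real.sq_sqrt hx.le
  have : 1 - (2 * √2 / (x * √x)) ^ 2 = (x ^ 3 - 8) / (x * √x) ^ 2 := by
    rw [div_pow, mul_pow, mul_pow, h2, hs2]
    field_simp
    ring
  rw [this, Real.sqrt_div' _ (sq_nonneg _), Real.sqrt_sq (by positivity)]

theorem two_sqrt_two_div_mem_Ioo {x : ℝ} (hx : 2 < x) :
    2 * √2 / (x * √x) ∈ Set.Ioo (0 : ℝ) 1 := by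
  have hs : √2 < √x := Real.sqrt_lt_sqrt (by norm_num) hx
  have h2 : 0 < √(2 : ℝ) := by positivity
  refine ⟨by positivity, ?_⟩
  rw [div_lt_one (by positivity)]
  nlinarith

theorem J_zero_eq {x : ℝ} (hx : 2 < x) :
    J 0 x = 2 * √2 * x / √(x ^ 3 - 8) * Real.arccos (2 * √2 / (x * √x)) := by
  have hx0 : 0 < x := by linarith
  have h8 : 0 < x ^ 3 - 8 := by
    have := pow_lt_pow_left₀ hx (by norm_num) (n := 3) (by norm_num)
    linarith
  have hw : 0 < √(x ^ 3 - 8) := Real.sqrt_pos.2 h8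
  have h2 : √(2 : ℝ) ^ 2 = 2 := Real.sq_sqrt (by norm_num)
  have hs : 0 < √x := Real.sqrt_pos.2 hx0
  have hab : x / 2 - 4 / x ^ 2 = (x ^ 3 - 8) / 2 / x ^ 2 := by
    field_simp
    ring
  have hJ : J 0 x = ∫ z in Set.Ioi (0 : ℝ), 1 / ((z + x / 2) * √(z + 4 / x ^ 2)) := by
    refine MeasureTheory.setIntegral_congr_fun measurableSet_Ioi fun z hz => ?_
    have hz : 0 < z := hz
    have hr : √(0 ^ 2 + x ^ 2) = x := by
      rw [zero_pow two_ne_zero, zero_add, Real.sqrt_sq hx0.le]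
    have hq : z ^ 2 + x * z + x ^ 2 / 4 = (z + x / 2) ^ 2 := by ring
    simp only [hr, hq]
    rw [Real.sqrt_mul (by positivity), Real.sqrt_sq (by positivity), mul_comm]
  have hc : √(x / 2 - 4 / x ^ 2) = √(x ^ 3 - 8) / (√2 * x) := by
    rw [hab, Real.sqrt_div (by positivity), Real.sqrt_div h8.le, Real.sqrt_sq hx0.le, div_div]
  have ha : √(4 / x ^ 2) = 2 / x := by
    rw [show 4 / x ^ 2 = (2 / x) ^ 2 by ring, Real.sqrt_sq (by positivity)]
  obtain ⟨hy0, hy1⟩ := two_sqrt_two_div_mem_Ioo hx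
  rw [hJ, integral_Ioi_one_div_mul_sqrt_add (by positivity)
    (sub_pos.1 (by rw [hab]; positivity)), hc, ha,
    Real.arccos_eq_pi_div_two_sub_arcsin, Real.arcsin_eq_arctan ⟨by linarith, hy1⟩,
    sqrt_one_sub_sq_two_sqrt_two_div hx0]
  have e1 : 2 / x / (√(x ^ 3 - 8) / (√2 * x)) =
      2 * √2 / (x * √x) / (√(x ^ 3 - 8) / (x * √x)) := by field_simp
  have e2 : 2 / (√(x ^ 3 - 8) / (√2 * x)) = 2 * √2 * x / √(x ^ 3 - 8) := by field_simp
  rw [e1, e2]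

/-- For every real `q2 > 2`, the function `x ↦ J(0,x)` is differentiable at `q2` with
derivative `12/(q2³ − 8) − √2·(q2³ + 16)·arccos(2√2/q2^(3/2)) / ((q2³ − 8)·√(q2³ − 8))`. -/
theorem hasDerivAt_J_on_plane (q2 : ℝ) (hq2 : 2 < q2) :
    HasDerivAt (fun x : ℝ => J 0 x)
      (12 / (q2 ^ 3 - 8) -
        Real.sqrt 2 * (q2 ^ 3 + 16) *
            Real.arccos (2 * Real.sqrt 2 / q2 ^ ((3 : ℝ) / 2)) /
          ((q2 ^ 3 - 8) * Real.sqrt (q2 ^ 3 - 8))) q2 := by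
  have hx0 : 0 < q2 := by linarith
  have h8 : 0 < q2 ^ 3 - 8 := by
    have := pow_lt_pow_left₀ hq2 (by norm_num) (n := 3) (by norm_num)
    linarith
  rw [rpow_three_halves_eq_mul_sqrt hx0]
  have hev : (fun x : ℝ => J 0 x) =ᶠ[nhds q2] fun x =>
      2 * √2 * x / √(x ^ 3 - 8) * Real.arccos (2 * √2 / (x * √x)) := by
    filter_upwards [lt_mem_nhds hq2] with x hx using J_zero_eq hx
  refine HasDerivAt.congr_of_eventuallyEq ?_ hev
  have hw : 0 < √(q2 ^ 3 - 8) := Real.sqrt_pos.2 h8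
  have hw2 : √(q2 ^ 3 - 8) ^ 2 = q2 ^ 3 - 8 := Real.sq_sqrt h8.le
  have h2 : √(2 : ℝ) ^ 2 = 2 := Real.sq_sqrt (by norm_num)
  have hs : 0 < √q2 := Real.sqrt_pos.2 hx0
  have hs2 : √q2 ^ 2 = q2 := Real.sq_sqrt hx0.le
  obtain ⟨hy0, hy1⟩ := two_sqrt_two_div_mem_Ioo hq2
  have hden : HasDerivAt (fun x : ℝ => √(x ^ 3 - 8)) (3 * q2 ^ 2 / (2 * √(q2 ^ 3 - 8))) q2 := by
    simpa using ((hasDerivAt_pow 3 q2).sub_const 8).sqrt h8.ne'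
  have hpre : HasDerivAt (fun x : ℝ => 2 * √2 * x / √(x ^ 3 - 8))
      (-(√2 * (q2 ^ 3 + 16)) / ((q2 ^ 3 - 8) * √(q2 ^ 3 - 8))) q2 := by
    refine (((hasDerivAt_id q2).const_mul (2 * √2)).div hden hw.ne').congr_deriv ?_
    simp only [id, hw2]
    field_simp
    rw [hw2]
    ring
  have harg : HasDerivAt (fun x : ℝ => 2 * √2 / (x * √x)) (-(3 * √2) / (q2 ^ 2 * √q2)) q2 := by
    refine ((hasDerivAt_const q2 (2 * √2)).div
      ((hasDerivAt_id q2).mul (Real.hasDerivAt_sqrt hx0.ne')) (mul_pos hx0 hs).ne').congr_deriv ?_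
    simp only [id, Pi.mul_apply]
    field_simp
    rw [hs2]
    ring
  have harccos : HasDerivAt (fun x : ℝ => Real.arccos (2 * √2 / (x * √x)))
      (3 * √2 / (q2 * √(q2 ^ 3 - 8))) q2 := by
    refine ((Real.hasDerivAt_arccos (by linarith) hy1.ne).comp q2 harg).congr_deriv ?_
    rw [sqrt_one_sub_sq_two_sqrt_two_div hx0]
    field_simp
  refine (hpre.mul harccos).congr_deriv ?_
  have hlead : 2 * √2 * q2 / √(q2 ^ 3 - 8) * (3 * √2 / (q2 * √(q2 ^ 3 - 8))) =
      12 / (q2 ^ 3 - 8) := by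
    field_simp
    rw [hw2, h2]
    ring
  rw [hlead]
  ring
end

section
/- If x > 2 is a real number at which the derivative of q2 ↦ J(0,q2) vanishes, then the point (q1,q2,p1,p2) = (0,x,0,0) is an equilibrium of the full Hamiltonian system: all four partial derivatives of H vanish at (0,x,0,0). -/
/-- The derivative at the origin of an even real function vanishes. -/
theorem deriv_zero_of_even {f : ℝ → ℝ} (hf : ∀ t, f (-t) = f t) : deriv f 0 = 0 := by
  have h := deriv_comp_neg f (0 : ℝ)
  simp only [hf, neg_zero] at h
  linarith

/-- If `x > 2` is a critical point of `q2 ↦ J(0,q2)`, then `(0,x,0,0)` is an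
equilibrium of the full Hamiltonian system: all four partial derivatives of `H`
vanish at `(q1,q2,p1,p2) = (0,x,0,0)`. -/
theorem full_equilibrium (x : ℝ) (hx : 2 < x)
    (hcrit : deriv (fun q2 : ℝ => J 0 q2) x = 0) :
    deriv (fun a : ℝ => H a x 0 0) 0 = 0 ∧
    deriv (fun b : ℝ => H 0 b 0 0) x = 0 ∧
    deriv (fun c : ℝ => H 0 x c 0) 0 = 0 ∧
    deriv (fun d : ℝ => H 0 x 0 d) 0 = 0 := by
  refine ⟨deriv_zero_of_even fun a => ?_, ?_, deriv_zero_of_even fun c => ?_,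
    deriv_zero_of_even fun d => ?_⟩
  · simp only [H, J, neg_sq]
  · simpa [H] using hcrit
  · simp only [H, neg_sq]
  · simp only [H, neg_sq]
end

section
/- The self-gravitation potential on the invariant plane decays like the inverse square root of the size of the ellipsoid: lim_{q2 → ∞} √q2 · J(0,q2) = √2·π. -/
/-- The elementary integral `∫₀^∞ dz / (√(z + a) (z + a + c))` for `a, c > 0`. -/
theorem integral_Ioi_one_div_sqrt_add_mul_add {a c : ℝ} (ha : 0 < a) (hc : 0 < c) :
    ∫ z in Set.Ioi (0 : ℝ), 1 / (Real.sqrt (z + a) * (z + a + c)) =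
      2 / Real.sqrt c * (Real.pi / 2 - Real.arctan (Real.sqrt a / Real.sqrt c)) := by
  have hsc : 0 < Real.sqrt c := Real.sqrt_pos.2 hc
  have hderiv : ∀ z ∈ Set.Ici (0 : ℝ),
      HasDerivAt (fun z => 2 / Real.sqrt c * Real.arctan (Real.sqrt (z + a) / Real.sqrt c))
        (1 / (Real.sqrt (z + a) * (z + a + c))) z := by
    intro z hz
    have hza : 0 < z + a := add_pos_of_nonneg_of_pos hz ha
    have hs : 0 < Real.sqrt (z + a) := Real.sqrt_pos.2 hza
    have h := (((((hasDerivAt_id z).add_const a).sqrt hza.ne').div_const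
      (Real.sqrt c)).arctan).const_mul (2 / Real.sqrt c)
    refine h.congr_deriv ?_
    simp only [id]
    rw [div_pow, Real.sq_sqrt hza.le, Real.sq_sqrt hc.le]
    have hne : c + (z + a) ≠ 0 := by positivity
    have hne' : z + a + c ≠ 0 := by positivity
    have hcc : Real.sqrt c ^ 2 = c := Real.sq_sqrt hc.le
    field_simp
    rw [hcc]
    field_simp
    ring
  have hlim : Filter.Tendsto
      (fun z => 2 / Real.sqrt c * Real.arctan (Real.sqrt (z + a) / Real.sqrt c))
      Filter.atTop (nhds (2 / Real.sqrt c * (Real.pi / 2))) := by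
    refine Filter.Tendsto.const_mul _ ?_
    refine (Real.tendsto_arctan_atTop.mono_right nhdsWithin_le_nhds).comp ?_
    exact (Real.tendsto_sqrt_atTop.comp
      (Filter.tendsto_atTop_add_const_right _ a Filter.tendsto_id)).atTop_div_const hsc
  rw [MeasureTheory.integral_Ioi_of_hasDerivAt_of_nonneg' hderiv ?_ hlim]
  · rw [zero_add, mul_sub]
  · intro z hz
    have hz' : 0 < z := hz
    positivity

/-- Closed form of the potential on the invariant plane `q1 = 0`. -/
theorem J_zero_left {q : ℝ} (hq : 2 < q) :
    J 0 q = 2 / Real.sqrt (q / 2 - 4 / q ^ 2) *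
      (Real.pi / 2 -
        Real.arctan (Real.sqrt (4 / q ^ 2) / Real.sqrt (q / 2 - 4 / q ^ 2))) := by
  have hq0 : 0 < q := by linarith
  have hc : 0 < q / 2 - 4 / q ^ 2 := by
    have : 4 / q ^ 2 < 1 := by
      rw [div_lt_one (by positivity)]
      nlinarith
    linarith
  rw [← integral_Ioi_one_div_sqrt_add_mul_add (by positivity) hc, J]
  refine MeasureTheory.setIntegral_congr_fun measurableSet_Ioi fun z hz => ?_
  have hz' : 0 < z := hz
  have hsq : z ^ 2 + Real.sqrt (0 ^ 2 + q ^ 2) * z + q ^ 2 / 4 = (z + q / 2) ^ 2 := by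
    rw [zero_pow two_ne_zero, zero_add, Real.sqrt_sq hq0.le]
    ring
  have hadd : z + 4 / q ^ 2 + (q / 2 - 4 / q ^ 2) = z + q / 2 := by ring
  simp only [hsq, hadd]
  rw [Real.sqrt_mul (by positivity), Real.sqrt_sq (by positivity)]

/-- The self-gravitation potential on the invariant plane decays like the inverse
square root of the size of the ellipsoid: `lim_{q2 → ∞} √q2 · J(0,q2) = √2·π`. -/
theorem J_asymptotics :
    Filter.Tendsto (fun q2 : ℝ => Real.sqrt q2 * J 0 q2) Filter.atTop
      (nhds (Real.sqrt 2 * Real.pi)) := by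
  have hinv (n : ℕ) (hn : n ≠ 0) (k : ℝ) :
      Filter.Tendsto (fun q : ℝ => k / q ^ n) Filter.atTop (nhds 0) :=
    (Filter.tendsto_pow_atTop hn).const_div_atTop k
  have hratio : Filter.Tendsto (fun q : ℝ => Real.sqrt (1 / (1 / 2 - 4 / q ^ 3)))
      Filter.atTop (nhds (Real.sqrt 2)) := by
    have h := ((tendsto_const_nhds (x := (1 : ℝ))).div
      ((tendsto_const_nhds (x := (1 / 2 : ℝ))).sub (hinv 3 three_ne_zero 4))
      (by norm_num)).sqrt
    norm_num at h ⊢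
    exact h
  have hangle : Filter.Tendsto
      (fun q : ℝ => Real.arctan (Real.sqrt (4 / q ^ 3 * (1 / (1 / 2 - 4 / q ^ 3)))))
      Filter.atTop (nhds 0) := by
    have h := ((hinv 3 three_ne_zero 4).mul ((tendsto_const_nhds (x := (1 : ℝ))).div
      ((tendsto_const_nhds (x := (1 / 2 : ℝ))).sub (hinv 3 three_ne_zero 4))
      (by norm_num))).sqrt
    replace h := (Real.continuous_arctan.tendsto _).comp h
    rw [zero_mul, Real.sqrt_zero, Real.arctan_zero] at h
    exact h
  have hlim := (hratio.mul_const 2).mul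
    ((tendsto_const_nhds (x := Real.pi / 2)).sub hangle)
  have hval : Real.sqrt 2 * 2 * (Real.pi / 2 - 0) = Real.sqrt 2 * Real.pi := by ring
  rw [hval] at hlim
  refine hlim.congr' ?_
  filter_upwards [Filter.eventually_gt_atTop 2] with q hq
  have hq0 : 0 < q := by linarith
  have hfac : q / 2 - 4 / q ^ 2 = q * (1 / 2 - 4 / q ^ 3) := by
    field_simp
  have h1 : 1 / (1 / 2 - 4 / q ^ 3) = q / (q / 2 - 4 / q ^ 2) := by
    rw [hfac, div_mul_eq_div_div, div_self hq0.ne']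
  have h2 : 4 / q ^ 3 * (q / (q / 2 - 4 / q ^ 2)) =
      4 / q ^ 2 / (q / 2 - 4 / q ^ 2) := by
    rw [← mul_div_assoc]
    congr 1
    field_simp
  rw [J_zero_left hq, h1, h2, Real.sqrt_div hq0.le, Real.sqrt_div (by positivity)]
  ring
end
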